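/- Let n ≥ 2 and q, r ∈ [1, ∞]. The following are equivalent: (a) there exists C such that for every measurable f : (0,1) → ℝ, ‖f‖_{L^r(0,1)} ≤ C ( ‖ t^{−1/n} ( f**(t) − f*(t) ) ‖_{L^q(0,1)} + ‖f‖_{L^1(0,1)} ); (b) there exists C′ such that for every measurable g : (0,1) → [0, ∞), ‖ ∫_t^1 s^{1/n} g(s) (ds/s) ‖_{L^r(0,1)} ≤ C′ ‖g‖_{L^q(0,1)}. -/

import Mathlib

open MeasureTheory Set
open scoped ENNReal NNReal

noncomputable section

/-- The decreasing rearrangement of `u` with respect to the measure `μ`: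
`u*(t) = inf { λ ≥ 0 : μ{|u| > λ} ≤ t }`. -/
def decRearr {α : Type*} [MeasurableSpace α] (μ : Measure α) (u : α → ℝ) (t : ℝ) : ℝ :=
  sInf {l : ℝ | 0 ≤ l ∧ μ {x | l < |u x|} ≤ ENNReal.ofReal t}

/-- `u**(t) = (1/t) ∫₀ᵗ u*(s) ds`. -/
def decRearrAvg {α : Type*} [MeasurableSpace α] (μ : Measure α) (u : α → ℝ) (t : ℝ) : ℝ :=
  (1 / t) * ∫ s in Ioc (0 : ℝ) t, decRearr μ u s

abbrev Euc (n : ℕ) := EuclideanSpace ℝ (Fin n)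

/-- `|∇f|(x)`, using the a.e. defined differential (Rademacher's theorem for
locally Lipschitz functions). -/
def gradNorm {n : ℕ} (f : Euc n → ℝ) (x : Euc n) : ℝ := ‖fderiv ℝ f x‖

/-- The admissible class `W(Ω)`: locally Lipschitz on `Ω`, with `f` and `|∇f|`
integrable on `Ω`. -/
def MemW {n : ℕ} (Ω : Set (Euc n)) (f : Euc n → ℝ) : Prop :=
  (∀ x ∈ Ω, ∃ s ∈ nhds x, ∃ K : ℝ≥0, LipschitzOnWith K f s) ∧
    IntegrableOn f Ω ∧ IntegrableOn (gradNorm f) Ω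

/-- `Ω` satisfies the `p`-Sobolev–Poincaré inequality with constant `C₀`. -/
def SPIneq {n : ℕ} (Ω : Set (Euc n)) (p C₀ : ℝ) : Prop :=
  ∀ f : Euc n → ℝ, MemW Ω f →
    (∫ x in Ω, |f x - ∫ y in Ω, f y| ^ p) ^ (1 / p) ≤ C₀ * ∫ x in Ω, gradNorm f x

/-- `r` is a median of `f` on `Ω` (with `|Ω| = 1`). -/
def IsMedian {n : ℕ} (Ω : Set (Euc n)) (f : Euc n → ℝ) (r : ℝ) : Prop :=
  1 / 2 ≤ volume {x ∈ Ω | r ≤ f x} ∧ 1 / 2 ≤ volume {x ∈ Ω | f x ≤ r}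

/-- The `L^p(0,1)` norm (with values in `ℝ≥0∞`, allowing `p = ∞`) of an
`ℝ≥0∞`-valued function on `(0,1)`. -/
def eLp01 (F : ℝ → ℝ≥0∞) (p : ℝ≥0∞) : ℝ≥0∞ :=
  if p = ∞ then essSup F (volume.restrict (Ioo (0 : ℝ) 1))
  else (∫⁻ t in Ioo (0 : ℝ) 1, F t ^ p.toReal) ^ (1 / p.toReal)


abbrev m01 : Measure ℝ := volume.restrict (Ioo (0 : ℝ) 1)

instance m01_prob : IsProbabilityMeasure m01 := ⟨by simp [m01]⟩

lemma eLp01_eq (F : ℝ → ℝ≥0∞) (p : ℝ≥0∞) (hp : 1 ≤ p) : eLp01 F p = eLpNorm F p m01 := by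
  have hp0 : p ≠ 0 := by rintro rfl; simp at hp
  unfold eLp01
  split_ifs with h
  · subst h; simp [eLpNorm_exponent_top, eLpNormEssSup]
  · rw [eLpNorm_eq_lintegral_rpow_enorm_toReal hp0 h]; simp

lemma eLpNorm_congr01 {E F : Type*} [ENorm E] [ENorm F] {f : ℝ → E} {g : ℝ → F} (p : ℝ≥0∞)
    (h : ∀ t ∈ Ioo (0 : ℝ) 1, ‖f t‖ₑ = ‖g t‖ₑ) : eLpNorm f p m01 = eLpNorm g p m01 := by
  apply eLpNorm_congr_enorm_ae
  filter_upwards [ae_restrict_mem measurableSet_Ioo] with t ht using h t ht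

lemma decRearr_bdd {α : Type*} [MeasurableSpace α] (μ : Measure α) (u : α → ℝ) (t : ℝ) :
    BddBelow {l : ℝ | 0 ≤ l ∧ μ {x | l < |u x|} ≤ ENNReal.ofReal t} := ⟨0, fun _ h => h.1⟩

lemma decRearr_nonneg {α : Type*} [MeasurableSpace α] (μ : Measure α) (u : α → ℝ) (t : ℝ) :
    0 ≤ decRearr μ u t := Real.sInf_nonneg fun _ h => h.1

lemma decRearr_nonempty {α : Type*} [MeasurableSpace α] (μ : Measure α) [IsFiniteMeasure μ]
    (u : α → ℝ) (hu : Measurable u) (t : ℝ) (ht : 0 < t) :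
    {l : ℝ | 0 ≤ l ∧ μ {x | l < |u x|} ≤ ENNReal.ofReal t}.Nonempty := by
  have hanti : Antitone fun k : ℕ => {x | (k : ℝ) < |u x|} := by
    intro a b hab x hx
    simp only [mem_ofPred_eq] at hx ⊢
    exact lt_of_le_of_lt (by exact_mod_cast hab) hx
  have h := tendsto_measure_iInter_atTop (μ := μ) (s := fun k : ℕ => {x | (k : ℝ) < |u x|})
    (fun k => (measurableSet_lt measurable_const hu.abs).nullMeasurableSet) hanti
    ⟨0, measure_ne_top _ _⟩
  have he : (⋂ k : ℕ, {x | (k : ℝ) < |u x|}) = ∅ := by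
    ext x
    simp only [mem_iInter, mem_ofPred_eq, mem_empty_iff_false, iff_false, not_forall, not_lt]
    exact exists_nat_ge _
  rw [he, measure_empty] at h
  have := (h.eventually (gt_mem_nhds (ENNReal.ofReal_pos.2 ht))).exists
  obtain ⟨k, hk⟩ := this
  exact ⟨k, Nat.cast_nonneg k, hk.le⟩

lemma lt_decRearr {α : Type*} [MeasurableSpace α] (μ : Measure α) [IsFiniteMeasure μ]
    (u : α → ℝ) (hu : Measurable u) (t : ℝ) (ht : 0 < t) (l : ℝ) (hl : 0 ≤ l) :
    l < decRearr μ u t ↔ ENNReal.ofReal t < μ {x | l < |u x|} := by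
  constructor
  · intro h
    by_contra! h'
    exact absurd (csInf_le (decRearr_bdd μ u t) ⟨hl, h'⟩) (not_le.2 h)
  · intro h
    have hmono : Monotone fun k : ℕ => {x | l + 1 / ((k : ℝ) + 1) < |u x|} := by
      intro a b hab x hx
      simp only [mem_ofPred_eq] at hx ⊢
      have := Nat.one_div_le_one_div (α := ℝ) hab
      linarith
    have hU : {x | l < |u x|} = ⋃ k : ℕ, {x | l + 1 / ((k : ℝ) + 1) < |u x|} := by
      ext x
      simp only [mem_ofPred_eq, mem_iUnion]
      constructor
      · intro hx
        obtain ⟨k, hk⟩ := exists_nat_one_div_lt (sub_pos.2 hx)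
        exact ⟨k, by linarith⟩
      · rintro ⟨k, hk⟩
        have : 0 < 1 / ((k : ℝ) + 1) := Nat.one_div_pos_of_nat
        linarith
    rw [hU, hmono.measure_iUnion, lt_iSup_iff] at h
    obtain ⟨k, hk⟩ := h
    have hp : 0 < 1 / ((k : ℝ) + 1) := Nat.one_div_pos_of_nat
    refine lt_of_lt_of_le (by linarith : l < l + 1 / ((k : ℝ) + 1)) ?_
    refine le_csInf (decRearr_nonempty μ u hu t ht) ?_
    rintro b ⟨hb, hb'⟩
    by_contra! hlt
    refine absurd (hk.trans_le ((measure_mono ?_).trans hb')) (lt_irrefl _)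
    intro x hx
    exact lt_trans hlt hx

/-- the rearrangement cut to the unit interval -/
def rs (f : ℝ → ℝ) : ℝ → ℝ := (Ioo (0 : ℝ) 1).indicator (decRearr m01 f)

lemma rs_anti (f : ℝ → ℝ) (hf : Measurable f) {s t : ℝ} (hs : 0 < s) (hst : s ≤ t) :
    decRearr m01 f t ≤ decRearr m01 f s := by
  refine csInf_le_csInf (decRearr_bdd _ _ _) (decRearr_nonempty _ f hf s hs) ?_
  rintro l ⟨h0, h1⟩
  exact ⟨h0, h1.trans (ENNReal.ofReal_le_ofReal hst)⟩

lemma rs_Ioi (f : ℝ → ℝ) (hf : Measurable f) (l : ℝ) (hl : 0 ≤ l) :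
    rs f ⁻¹' (Ioi l) = Ioo 0 (m01 {x | l < |f x|}).toReal := by
  have h1 : m01 {x | l < |f x|} ≤ 1 := prob_le_one
  ext t
  simp only [mem_preimage, mem_Ioi, mem_Ioo, rs]
  by_cases ht : t ∈ Ioo (0 : ℝ) 1
  · rw [indicator_of_mem ht, lt_decRearr _ f hf t ht.1 l hl,
      ENNReal.ofReal_lt_iff_lt_toReal ht.1.le (measure_ne_top _ _)]
    simp [ht.1]
  · rw [indicator_of_notMem ht]
    constructor
    · intro h; exact absurd h (not_lt.2 hl)
    · rintro ⟨h0, h2⟩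
      refine absurd ⟨h0, h2.trans_le ?_⟩ ht
      exact ENNReal.toReal_le_of_le_ofReal zero_le_one (by simpa using h1)

lemma rs_nonneg (f : ℝ → ℝ) (t : ℝ) : 0 ≤ rs f t :=
  indicator_nonneg (fun _ _ => decRearr_nonneg _ _ _) _

lemma rs_meas (f : ℝ → ℝ) (hf : Measurable f) : Measurable (rs f) := by
  refine measurable_of_Ioi fun l => ?_
  rcases le_or_gt 0 l with hl | hl
  · rw [rs_Ioi f hf l hl]; exact measurableSet_Ioo
  · have : rs f ⁻¹' (Ioi l) = univ := by
      ext t; simp [hl.trans_le (rs_nonneg f t)]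
    rw [this]; exact MeasurableSet.univ

lemma rs_ident (f : ℝ → ℝ) (hf : Measurable f) (p : ℝ≥0∞) :
    eLpNorm (rs f) p m01 = eLpNorm f p m01 := by
  have hmap : m01.map (rs f) = m01.map (fun x => |f x|) := by
    have i1 := Measure.isProbabilityMeasure_map (μ := m01) (rs_meas f hf).aemeasurable
    have i2 := Measure.isProbabilityMeasure_map (μ := m01) hf.abs.aemeasurable
    refine Measure.ext_of_Iic _ _ fun l => ?_
    rw [← compl_Ioi, prob_compl_eq_one_sub measurableSet_Ioi,
      prob_compl_eq_one_sub measurableSet_Ioi]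
    congr 1
    rw [Measure.map_apply (rs_meas f hf) measurableSet_Ioi, Measure.map_apply hf.abs measurableSet_Ioi]
    rcases le_or_gt 0 l with hl | hl
    · rw [rs_Ioi f hf l hl]
      have h1 : m01 {x | l < |f x|} ≤ 1 := prob_le_one
      have h2 : (m01 {x | l < |f x|}).toReal ≤ 1 := 
        ENNReal.toReal_le_of_le_ofReal zero_le_one (by simpa using h1)
      have : m01 (Ioo 0 (m01 {x | l < |f x|}).toReal) = volume (Ioo 0 (m01 {x | l < |f x|}).toReal) := by
        rw [m01, Measure.restrict_apply measurableSet_Ioo,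
          inter_eq_left.2 (Ioo_subset_Ioo le_rfl h2)]
      rw [this, Real.volume_Ioo, sub_zero, ENNReal.ofReal_toReal (measure_ne_top _ _)]
      rfl
    · have e1 : rs f ⁻¹' (Ioi l) = univ := by
        ext t; simp [hl.trans_le (rs_nonneg f t)]
      have e2 : (fun x => |f x|) ⁻¹' (Ioi l) = univ := by
        ext t; simp [hl.trans_le (abs_nonneg (f t))]
      rw [e1, e2]
  have h := eLpNorm_map_measure (μ := m01) (p := p) (g := (id : ℝ → ℝ)) (f := rs f)
    measurable_id.aestronglyMeasurable (rs_meas f hf).aemeasurable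
  have h' := eLpNorm_map_measure (μ := m01) (p := p) (g := (id : ℝ → ℝ)) (f := fun x => |f x|)
    measurable_id.aestronglyMeasurable hf.abs.aemeasurable
  rw [hmap, h'] at h
  simp only [Function.id_comp] at h
  rw [← h]
  exact eLpNorm_congr01 p fun t _ => by simp

lemma fub (A : Set ℝ) (a b : ℝ → ℝ≥0∞) (ha : Measurable a)
    (hb : Measurable b) :
    ∫⁻ s in A, b s * ∫⁻ u in Ioc 0 s, a u = ∫⁻ u in Ioi 0, a u * ∫⁻ s in A ∩ Ici u, b s := by
  have e1 : ∀ s, b s * ∫⁻ u in Ioc 0 s, a u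
      = ∫⁻ u in Ioi 0, {p : ℝ × ℝ | p.2 ≤ p.1}.indicator (fun p => b p.1 * a p.2) (s, u) := by
    intro s
    rw [← lintegral_const_mul _ ha, ← Ioi_inter_Iic, inter_comm,
      ← setLIntegral_indicator measurableSet_Iic]
    rfl
  have e2 : ∀ u, a u * ∫⁻ s in A ∩ Ici u, b s
      = ∫⁻ s in A, {p : ℝ × ℝ | p.2 ≤ p.1}.indicator (fun p => b p.1 * a p.2) (s, u) := by
    intro u
    rw [← lintegral_const_mul _ hb, inter_comm,
      ← setLIntegral_indicator measurableSet_Ici]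
    refine lintegral_congr fun s => ?_
    simp only [indicator, mem_Ici, mem_ofPred_eq, mul_comm]
  simp_rw [e1, e2]
  refine lintegral_lintegral_swap ?_
  refine Measurable.aemeasurable ?_
  exact Measurable.indicator (by fun_prop) (measurableSet_le measurable_snd measurable_fst)

lemma lint_rpow (a b r : ℝ) (ha : 0 < a) (hab : a ≤ b) (hr : r ≠ -1) :
    ∫⁻ s in Ioc a b, ENNReal.ofReal (s ^ r)
      = ENNReal.ofReal ((b ^ (r + 1) - a ^ (r + 1)) / (r + 1)) := by
  have h0 : (0 : ℝ) ∉ uIcc a b := by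
    rw [uIcc_of_le hab]; intro h; exact absurd h.1 (not_le.2 ha)
  rw [← integral_rpow (Or.inr ⟨hr, h0⟩), intervalIntegral.integral_of_le hab,
    ofReal_integral_eq_lintegral_ofReal]
  · exact (intervalIntegrable_iff_integrableOn_Ioc_of_le hab).1
      (intervalIntegral.intervalIntegrable_rpow (Or.inr h0))
  · filter_upwards [ae_restrict_mem measurableSet_Ioc] with s hs
    exact Real.rpow_nonneg (ha.le.trans hs.1.le) _

lemma lint_inv_sq (a : ℝ) (ha : 0 < a) (ha1 : a ≤ 1) :
    (∫⁻ s in Ioc a 1, ENNReal.ofReal (s ^ (-2 : ℝ))) + 1 = ENNReal.ofReal (1 / a) := by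
  rw [lint_rpow a 1 _ ha ha1 (by norm_num)]
  have h : (1 : ℝ) ≤ 1 / a := by rw [le_div_iff₀ ha]; linarith
  have : ((1 : ℝ) ^ ((-2 : ℝ) + 1) - a ^ ((-2 : ℝ) + 1)) / ((-2 : ℝ) + 1) = 1 / a - 1 := by
    norm_num [Real.rpow_neg_one]
    ring
  rw [this, ← ENNReal.ofReal_one, ← ENNReal.ofReal_add (by linarith) zero_le_one]
  congr 1; ring

lemma hardyId (φ : ℝ → ℝ≥0∞) (hφ : Measurable φ) (t : ℝ) (ht : 0 < t) (ht1 : t < 1) :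
    (∫⁻ s in Ioc t 1, ENNReal.ofReal (s ^ (-2 : ℝ)) * ∫⁻ u in Ioc 0 s, φ u)
      + ∫⁻ u in Ioc 0 1, φ u
    = ENNReal.ofReal (1 / t) * (∫⁻ u in Ioc 0 t, φ u)
      + ∫⁻ u in Ioc t 1, φ u * ENNReal.ofReal (1 / u) := by
  rw [fub (Ioc t 1) φ (fun s => ENNReal.ofReal (s ^ (-2 : ℝ))) hφ (by fun_prop)]
  have s1 : Ioi (0 : ℝ) = Ioc 0 1 ∪ Ioi 1 := (Ioc_union_Ioi_eq_Ioi zero_le_one).symm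
  have s2 : Ioc (0 : ℝ) 1 = Ioc 0 t ∪ Ioc t 1 := (Ioc_union_Ioc_eq_Ioc ht.le ht1.le).symm
  rw [s1, lintegral_union measurableSet_Ioi (Ioc_disjoint_Ioi le_rfl)]
  have z : ∫⁻ u in Ioi (1 : ℝ), φ u * ∫⁻ s in Ioc t 1 ∩ Ici u, ENNReal.ofReal (s ^ (-2 : ℝ)) = 0 := by
    rw [setLIntegral_congr_fun (g := fun _ => 0) measurableSet_Ioi]
    · simp
    · intro u hu
      have : Ioc t 1 ∩ Ici u = ∅ := by
        ext s; simp only [mem_inter_iff, mem_Ioc, mem_Ici, mem_empty_iff_false, iff_false]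
        rintro ⟨⟨_, h⟩, h'⟩
        exact absurd (mem_Ioi.1 hu) (not_lt.2 (h'.trans h))
      simp [this]
  rw [z, add_zero, ← lintegral_add_right _ hφ, s2,
    lintegral_union measurableSet_Ioc (Ioc_disjoint_Ioc_of_le le_rfl)]
  congr 1
  · rw [← lintegral_const_mul _ hφ]
    refine setLIntegral_congr_fun measurableSet_Ioc ?_
    intro u hu
    have : (Ioc 0 t ∪ Ioc t 1) = Ioc (0:ℝ) 1 := s2.symm
    have e : Ioc t 1 ∩ Ici u = Ioc t 1 := inter_eq_left.2 fun s hs => hu.2.trans hs.1.le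
    simp only [e]
    rw [← lint_inv_sq t ht ht1.le, add_mul, one_mul, mul_comm]
  · refine setLIntegral_congr_fun measurableSet_Ioc ?_
    intro u hu
    have e : Ioc t 1 ∩ Ici u = Icc u 1 := by
      ext s; simp only [mem_inter_iff, mem_Ioc, mem_Ici, mem_Icc]
      exact ⟨fun h => ⟨h.2, h.1.2⟩, fun h => ⟨⟨hu.1.trans_le h.1, h.2⟩, h.1⟩⟩
    simp only [e]
    rw [setLIntegral_congr Ioc_ae_eq_Icc.symm, ← lint_inv_sq u (ht.trans hu.1) hu.2, mul_add, mul_one]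

lemma lint_mono_set (φ : ℝ → ℝ≥0∞) : Monotone fun s : ℝ => ∫⁻ u in Ioc 0 s, φ u :=
  fun _ _ h => lintegral_mono_set (Ioc_subset_Ioc_right h)

lemma lint_anti_set (φ : ℝ → ℝ≥0∞) : Antitone fun s : ℝ => ∫⁻ u in Ioc s 1, φ u :=
  fun _ _ h => lintegral_mono_set (Ioc_subset_Ioc_left h)

lemma eLpNorm_one_Ioc (F : ℝ → ℝ≥0∞) : eLpNorm F 1 m01 = ∫⁻ u in Ioc 0 1, F u := by
  rw [eLpNorm_one_eq_lintegral_enorm, setLIntegral_congr Ioo_ae_eq_Ioc.symm]; simp [m01]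

/-- average of `rs f` -/
def Ph (f : ℝ → ℝ) (s : ℝ) : ℝ≥0∞ := ∫⁻ u in Ioc 0 s, ENNReal.ofReal (rs f u)

lemma avg_eq (f : ℝ → ℝ) (hf : Measurable f) (t : ℝ) (ht : t ∈ Ioo (0 : ℝ) 1) :
    decRearrAvg m01 f t = (1 / t) * (Ph f t).toReal := by
  unfold decRearrAvg Ph
  congr 1
  rw [setIntegral_congr_fun (g := rs f) measurableSet_Ioc,
    integral_eq_lintegral_of_nonneg_ae (ae_of_all _ (rs_nonneg f)) (rs_meas f hf).aestronglyMeasurable]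
  intro u hu
  have : u ∈ Ioo (0 : ℝ) 1 := ⟨hu.1, hu.2.trans_lt ht.2⟩
  simp [rs, this]

lemma b_to_a (n : ℕ) (hn : 2 ≤ n) (q r : ℝ≥0∞) (hq : 1 ≤ q) (hr : 1 ≤ r) (C' : ℝ) (hC' : 0 ≤ C')
    (H : ∀ g : ℝ → ℝ, Measurable g → (∀ s ∈ Ioo (0 : ℝ) 1, 0 ≤ g s) →
        eLp01 (fun t => ∫⁻ s in Ioc t 1, ENNReal.ofReal (s ^ ((1 : ℝ) / n) * g s / s)) r
          ≤ ENNReal.ofReal C' * eLp01 (fun t => ENNReal.ofReal (g t)) q)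
    (f : ℝ → ℝ) (hf : Measurable f) :
    eLpNorm f r m01 ≤ ENNReal.ofReal (C' + 1) *
      (eLpNorm (fun t => t ^ (-(1 : ℝ) / n) * (decRearrAvg m01 f t - decRearr m01 f t)) q m01
        + eLpNorm f 1 m01) := by
  by_cases hN : eLpNorm f 1 m01 = ∞
  · rw [hN, add_top, ENNReal.mul_top]
    · exact le_top
    · simp; linarith
  have hN1 : eLpNorm f 1 m01 = Ph f 1 := by
    unfold Ph
    rw [← rs_ident f hf, ← eLpNorm_one_Ioc]
    exact eLpNorm_congr01 1 fun t _ => by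
      rw [enorm_eq_self, Real.enorm_of_nonneg (rs_nonneg f t)]
  have hfin : ∀ s ≤ 1, Ph f s ≠ ∞ := fun s hs =>
    ne_top_of_le_ne_top (b := Ph f 1) (hN1 ▸ hN) (lint_mono_set _ hs)
  have hΦm : Measurable (Ph f) := (lint_mono_set _).measurable
  have hrm := rs_meas f hf
  set D : ℝ → ℝ := fun s => (1 / s) * (Ph f s).toReal - rs f s with hD
  have hDm : Measurable D := by fun_prop
  -- nonnegativity
  have hkey : ∀ s ∈ Ioc (0 : ℝ) 1, rs f s ≤ (1 / s) * (Ph f s).toReal := by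
    intro s hs
    have h1 : ENNReal.ofReal (rs f s) * ENNReal.ofReal s ≤ Ph f s := by
      have : ∫⁻ u in Ioc 0 s, ENNReal.ofReal (rs f s) ≤ Ph f s := by
        refine setLIntegral_mono (by fun_prop) fun u hu => ENNReal.ofReal_le_ofReal ?_
        by_cases h : s < 1
        · have hs' : s ∈ Ioo (0 : ℝ) 1 := ⟨hs.1, h⟩
          have hu' : u ∈ Ioo (0 : ℝ) 1 := ⟨hu.1, hu.2.trans_lt h⟩
          simp only [rs, indicator_of_mem hs', indicator_of_mem hu']
          exact rs_anti f hf hu.1 hu.2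
        · have : rs f s = 0 := by
            unfold rs; exact indicator_of_notMem (fun h' => h h'.2) _
          rw [this]; exact rs_nonneg f u
      simpa using this
    rw [← ENNReal.ofReal_mul (rs_nonneg f s), ENNReal.ofReal_le_iff_le_toReal (hfin s hs.2)] at h1
    rw [one_div, inv_mul_eq_div, le_div_iff₀ hs.1]
    exact h1
  set g : ℝ → ℝ := fun s => s ^ (-(1 : ℝ) / n) * D s with hg
  have hgm : Measurable g := by fun_prop
  have hg0 : ∀ s ∈ Ioo (0 : ℝ) 1, 0 ≤ g s := fun s hs =>
    mul_nonneg (Real.rpow_nonneg hs.1.le _) (sub_nonneg.2 (hkey s ⟨hs.1, hs.2.le⟩))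
  have hH := H g hgm hg0
  rw [eLp01_eq _ _ hr, eLp01_eq _ _ hq] at hH
  have hgq : eLpNorm (fun t => t ^ (-(1 : ℝ) / n) * (decRearrAvg m01 f t - decRearr m01 f t)) q m01
      = eLpNorm (fun t => ENNReal.ofReal (g t)) q m01 := by
    refine eLpNorm_congr01 q fun t ht => ?_
    rw [avg_eq f hf t ht, enorm_eq_self, ← Real.enorm_of_nonneg (hg0 t ht)]
    simp only [hg, hD, rs, indicator_of_mem ht]
  rw [hgq]
  set HH : ℝ → ℝ≥0∞ := fun t => ∫⁻ s in Ioc t 1, ENNReal.ofReal (s ^ ((1 : ℝ) / n) * g s / s) with hHH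
  have hHm : Measurable HH := (lint_anti_set _).measurable
  have hpt : ∀ t ∈ Ioo (0 : ℝ) 1, ENNReal.ofReal (rs f t) ≤ HH t + Ph f 1 := by
    intro t ht
    have id1 := hardyId (fun u => ENNReal.ofReal (rs f u)) (by fun_prop) t ht.1 ht.2
    have hP : ∫⁻ u in Ioc t 1, ENNReal.ofReal (rs f u) * ENNReal.ofReal (1 / u) ≠ ∞ := by
      have : ∫⁻ u in Ioc t 1, ENNReal.ofReal (rs f u) * ENNReal.ofReal (1 / u)
          ≤ Ph f 1 * ENNReal.ofReal (1 / t) := by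
        unfold Ph
        rw [← lintegral_mul_const _ (by fun_prop)]
        refine (setLIntegral_mono (by fun_prop) fun u hu => ?_).trans
          (lintegral_mono_set (Ioc_subset_Ioc_left ht.1.le))
        gcongr
        · exact ht.1
        · exact hu.1.le
      exact ne_top_of_le_ne_top (ENNReal.mul_ne_top (hfin 1 le_rfl) ENNReal.ofReal_ne_top) this
    have id2 : HH t + ∫⁻ u in Ioc t 1, ENNReal.ofReal (rs f u) * ENNReal.ofReal (1 / u)
        = ∫⁻ s in Ioc t 1, ENNReal.ofReal (s ^ (-2 : ℝ)) *
            ∫⁻ u in Ioc 0 s, ENNReal.ofReal (rs f u) := by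
      rw [hHH, ← lintegral_add_right _ (by fun_prop)]
      refine setLIntegral_congr_fun measurableSet_Ioc fun s hs => ?_
      have hs0 : 0 < s := ht.1.trans hs.1
      have hk := hkey s ⟨hs0, hs.2⟩
      have e1 : s ^ ((1 : ℝ) / n) * g s / s = D s * (1 / s) := by
        have : s ^ ((1 : ℝ) / n) * s ^ (-(1 : ℝ) / n) = 1 := by
          rw [← Real.rpow_add hs0, neg_div, add_neg_cancel, Real.rpow_zero]
        simp only [hg]
        rw [← mul_assoc, this]; ring
      change _ = ENNReal.ofReal (s ^ (-2 : ℝ)) * Ph f s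
      have hp : (0 : ℝ) ≤ 1 / s := by positivity
      simp only [e1]
      rw [← ENNReal.ofReal_mul (rs_nonneg f s), ← ENNReal.ofReal_add
        (mul_nonneg (sub_nonneg.2 hk) hp) (mul_nonneg (rs_nonneg f s) hp),
        ← ENNReal.ofReal_toReal (hfin s hs.2), ← ENNReal.ofReal_mul (by positivity)]
      congr 1
      have : s ^ (-2 : ℝ) = (1 / s) * (1 / s) := by
        rw [Real.rpow_neg hs0.le]; norm_num; field_simp
      rw [ENNReal.toReal_ofReal ENNReal.toReal_nonneg, this]; ring
    rw [← id2] at id1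
    change _ + Ph f 1 = _ * Ph f t + _ at id1
    rw [add_right_comm] at id1
    have id3 := (ENNReal.add_left_inj hP).1 id1
    rw [id3]
    have hk := hkey t ⟨ht.1, ht.2.le⟩
    rw [← ENNReal.ofReal_toReal (hfin t ht.2.le), ← ENNReal.ofReal_mul (by have := ht.1; positivity)]
    exact ENNReal.ofReal_le_ofReal hk
  have hr0 : r ≠ 0 := by rintro rfl; simp at hr
  calc eLpNorm f r m01 = eLpNorm (rs f) r m01 := (rs_ident f hf r).symm
    _ ≤ eLpNorm (HH + fun _ => Ph f 1) r m01 := by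
        refine eLpNorm_mono_enorm_ae ?_
        filter_upwards [ae_restrict_mem measurableSet_Ioo] with t ht
        rw [Real.enorm_of_nonneg (rs_nonneg f t), enorm_eq_self]
        exact hpt t ht
    _ ≤ eLpNorm HH r m01 + eLpNorm (fun _ : ℝ => Ph f 1) r m01 :=
        eLpNorm_add_le hHm.aestronglyMeasurable aestronglyMeasurable_const hr
    _ ≤ ENNReal.ofReal C' * eLpNorm (fun t => ENNReal.ofReal (g t)) q m01 + eLpNorm f 1 m01 := by
        gcongr
        rw [eLpNorm_const _ hr0 (IsProbabilityMeasure.ne_zero m01), hN1]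
        simp
    _ ≤ ENNReal.ofReal (C' + 1) * eLpNorm (fun t => ENNReal.ofReal (g t)) q m01
        + ENNReal.ofReal (C' + 1) * eLpNorm f 1 m01 := by
        gcongr
        · linarith
        · refine le_mul_of_one_le_left zero_le ?_
          rw [ENNReal.one_le_ofReal]; linarith
    _ = _ := by rw [mul_add]

lemma jensen (ν : Measure ℝ) (hν : ν univ ≤ 1) (G : ℝ → ℝ≥0∞) (hG : Measurable G) (k : ℝ)
    (hk : 1 ≤ k) : (∫⁻ s, G s ∂ν) ^ k ≤ ∫⁻ s, G s ^ k ∂ν := by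
  have h := eLpNorm_le_eLpNorm_mul_rpow_measure_univ (μ := ν) (f := G) (p := 1)
    (q := ENNReal.ofReal k) (by simpa using hk) hG.aestronglyMeasurable
  have hk0 : 0 < k := by linarith
  rw [eLpNorm_one_eq_lintegral_enorm, eLpNorm_eq_lintegral_rpow_enorm_toReal (by simpa using hk0)
    ENNReal.ofReal_ne_top, ENNReal.toReal_ofReal hk0.le] at h
  simp only [enorm_eq_self] at h
  have h2 : ν univ ^ (1 / (1 : ℝ≥0∞).toReal - 1 / k) ≤ 1 := by
    refine ENNReal.rpow_le_one hν ?_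
    have : 1 / k ≤ 1 := by rw [div_le_one hk0]; exact hk
    simp; simpa using this
  have h3 := h.trans (mul_le_of_le_one_right zero_le h2)
  calc _ ≤ ((∫⁻ s, G s ^ k ∂ν) ^ (1 / k)) ^ k := ENNReal.rpow_le_rpow h3 hk0.le
    _ = _ := by rw [← ENNReal.rpow_mul, one_div, inv_mul_cancel₀ hk0.ne', ENNReal.rpow_one]

/-- the Hardy average -/
def Th (n : ℕ) (G : ℝ → ℝ≥0∞) (t : ℝ) : ℝ≥0∞ :=
  ENNReal.ofReal (t ^ (-(1 : ℝ) / n - 1)) * ∫⁻ s in Ioc 0 t, ENNReal.ofReal (s ^ ((1 : ℝ) / n)) * G s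

lemma ker_mass (n : ℕ) (t : ℝ) (ht : 0 < t) :
    ENNReal.ofReal (t ^ (-(1 : ℝ) / n - 1)) * ∫⁻ s in Ioc 0 t, ENNReal.ofReal (s ^ ((1 : ℝ) / n)) ≤ 1 := by
  have : ∫⁻ s in Ioc 0 t, ENNReal.ofReal (s ^ ((1 : ℝ) / n))
      ≤ ∫⁻ s in Ioc 0 t, ENNReal.ofReal (t ^ ((1 : ℝ) / n)) := by
    refine setLIntegral_mono (by fun_prop) fun s hs => ENNReal.ofReal_le_ofReal ?_
    exact Real.rpow_le_rpow hs.1.le hs.2 (by positivity)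
  calc _ ≤ ENNReal.ofReal (t ^ (-(1 : ℝ) / n - 1)) * (ENNReal.ofReal (t ^ ((1 : ℝ) / n)) * ENNReal.ofReal t) := by
        gcongr; simpa using this
    _ = 1 := by
        rw [← ENNReal.ofReal_mul (by positivity), ← ENNReal.ofReal_mul (by positivity)]
        have : t ^ (-(1 : ℝ) / n - 1) * (t ^ ((1 : ℝ) / n) * t) = 1 := by
          nth_rewrite 3 [← Real.rpow_one t]
          rw [← Real.rpow_add ht, ← Real.rpow_add ht]
          ring_nf; simp
        rw [this, ENNReal.ofReal_one]

lemma Th_jensen (n : ℕ) (G : ℝ → ℝ≥0∞) (hG : Measurable G) (k : ℝ) (hk : 1 ≤ k) (t : ℝ) (ht : 0 < t) :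
    (Th n G t) ^ k ≤ Th n (fun s => G s ^ k) t := by
  have hw : Measurable fun s : ℝ => ENNReal.ofReal (s ^ ((1 : ℝ) / n)) := by fun_prop
  have key : ∀ F : ℝ → ℝ≥0∞, Measurable F → Th n F t = ∫⁻ s, F s ∂(ENNReal.ofReal (t ^ (-(1 : ℝ) / n - 1)) •
      (volume.restrict (Ioc 0 t)).withDensity (fun s : ℝ => ENNReal.ofReal (s ^ ((1 : ℝ) / n)))) := by
    intro F hF
    rw [lintegral_smul_measure, lintegral_withDensity_eq_lintegral_mul _ hw hF]
    rfl
  rw [key G hG, key _ (hG.pow_const k)]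
  refine jensen _ ?_ G hG k hk
  rw [Measure.smul_apply, withDensity_apply _ MeasurableSet.univ, Measure.restrict_univ]
  exact ker_mass n t ht

lemma Th_one (n : ℕ) (hn : 2 ≤ n) (F : ℝ → ℝ≥0∞) (hF : Measurable F) :
    ∫⁻ t in Ioo 0 1, Th n F t ≤ n * ∫⁻ s in Ioo 0 1, F s := by
  have hn0 : (0 : ℝ) < n := by positivity
  have hw : Measurable fun s : ℝ => ENNReal.ofReal (s ^ ((1 : ℝ) / n)) := by fun_prop
  unfold Th
  rw [fub (Ioo 0 1) (fun s => ENNReal.ofReal (s ^ ((1 : ℝ) / n)) * F s)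
    (fun t => ENNReal.ofReal (t ^ (-(1 : ℝ) / n - 1))) (hw.mul hF) (by fun_prop),
    ← lintegral_const_mul _ hF, ← lintegral_indicator measurableSet_Ioi,
    ← lintegral_indicator measurableSet_Ioo]
  refine lintegral_mono fun s => ?_
  by_cases hs0 : 0 < s
  swap
  · rw [indicator_of_notMem (by simpa using hs0)]; exact zero_le
  rw [indicator_of_mem (mem_Ioi.2 hs0)]
  by_cases hs1 : s < 1
  swap
  · have : Ioo (0 : ℝ) 1 ∩ Ici s = ∅ := by
      ext x; simp only [mem_inter_iff, mem_Ioo, mem_Ici, mem_empty_iff_false, iff_false]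
      rintro ⟨⟨_, h⟩, h'⟩; exact hs1 (h'.trans_lt h)
    simp [this]
  rw [indicator_of_mem (show s ∈ Ioo (0 : ℝ) 1 from ⟨hs0, hs1⟩)]
  have h1 : ∫⁻ t in Ioo 0 1 ∩ Ici s, ENNReal.ofReal (t ^ (-(1 : ℝ) / n - 1))
      ≤ ENNReal.ofReal (n * s ^ (-(1 : ℝ) / n)) := by
    refine (lintegral_mono_set (t := Icc s 1) fun x hx => ⟨hx.2, hx.1.2.le⟩).trans ?_
    have hne : -(1 : ℝ) / n - 1 ≠ -1 := by
      have : -(1 : ℝ) / n ≠ 0 := div_ne_zero (by norm_num) hn0.ne'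
      intro h; apply this; linarith
    rw [setLIntegral_congr Ioc_ae_eq_Icc.symm, lint_rpow s 1 _ hs0 hs1.le hne]
    refine ENNReal.ofReal_le_ofReal ?_
    rw [sub_add_cancel, Real.one_rpow]
    have : (1 - s ^ (-(1 : ℝ) / n)) / (-(1 : ℝ) / n) = n * s ^ (-(1 : ℝ) / n) - n := by
      field_simp; ring
    rw [this]; linarith
  calc _ ≤ ENNReal.ofReal (s ^ ((1 : ℝ) / n)) * F s * ENNReal.ofReal (n * s ^ (-(1 : ℝ) / n)) := by
        gcongr
    _ = (ENNReal.ofReal (s ^ ((1 : ℝ) / n)) * ENNReal.ofReal (n * s ^ (-(1 : ℝ) / n))) * F s := by ring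
    _ = n * F s := by
        rw [← ENNReal.ofReal_mul (by positivity)]
        have : s ^ ((1 : ℝ) / n) * (n * s ^ (-(1 : ℝ) / n)) = n := by
          rw [mul_left_comm, ← Real.rpow_add hs0, neg_div, add_neg_cancel, Real.rpow_zero, mul_one]
        rw [this, ENNReal.ofReal_natCast]
    _ ≤ _ := le_rfl

lemma Th_Lq (n : ℕ) (hn : 2 ≤ n) (q : ℝ≥0∞) (hq : 1 ≤ q) (G : ℝ → ℝ≥0∞) (hG : Measurable G) :
    eLpNorm (Th n G) q m01 ≤ n * eLpNorm G q m01 := by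
  have hn1 : (1 : ℝ≥0∞) ≤ n := by exact_mod_cast (by omega : 1 ≤ n)
  have hq0 : q ≠ 0 := by rintro rfl; simp at hq
  by_cases hqt : q = ∞
  · subst hqt
    refine le_trans ?_ (le_mul_of_one_le_left zero_le hn1)
    simp only [eLpNorm_exponent_top]
    refine essSup_le_of_ae_le _ ?_
    filter_upwards [ae_restrict_mem measurableSet_Ioo] with t ht
    rw [enorm_eq_self]
    have hM : ∀ᵐ s ∂(volume.restrict (Ioc 0 t)), G s ≤ eLpNormEssSup G m01 := by
      have h0 : ∀ᵐ s ∂m01, ‖G s‖ₑ ≤ eLpNormEssSup G m01 := enorm_ae_le_eLpNormEssSup G m01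
      refine ae_restrict_of_ae_restrict_of_subset (t := Ioo 0 1) ?_ h0
      exact fun x hx => ⟨hx.1, hx.2.trans_lt ht.2⟩
    unfold Th
    calc _ ≤ ENNReal.ofReal (t ^ (-(1 : ℝ) / n - 1)) *
          ∫⁻ s in Ioc 0 t, ENNReal.ofReal (s ^ ((1 : ℝ) / n)) * eLpNormEssSup G m01 := by
          gcongr 1
          refine lintegral_mono_ae ?_
          filter_upwards [hM] with s hs
          gcongr
      _ ≤ _ := by
          rw [lintegral_mul_const _ (by fun_prop), ← mul_assoc]
          exact mul_le_of_le_one_left zero_le (ker_mass n t ht.1)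
  · have hk : 1 ≤ q.toReal := by
      rw [← ENNReal.toReal_one]; exact ENNReal.toReal_mono hqt hq
    have hk0 : 0 < q.toReal := by linarith
    rw [eLpNorm_eq_lintegral_rpow_enorm_toReal hq0 hqt, eLpNorm_eq_lintegral_rpow_enorm_toReal hq0 hqt]
    simp only [enorm_eq_self]
    have h1 : ∫⁻ t, Th n G t ^ q.toReal ∂m01 ≤ n * ∫⁻ s, G s ^ q.toReal ∂m01 := by
      refine le_trans ?_ (Th_one n hn _ (hG.pow_const _))
      refine lintegral_mono_ae ?_
      filter_upwards [ae_restrict_mem measurableSet_Ioo] with t ht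
      exact Th_jensen n G hG _ hk t ht.1
    calc _ ≤ ((n : ℝ≥0∞) * ∫⁻ s, G s ^ q.toReal ∂m01) ^ (1 / q.toReal) :=
          ENNReal.rpow_le_rpow h1 (by positivity)
      _ = (n : ℝ≥0∞) ^ (1 / q.toReal) * (∫⁻ s, G s ^ q.toReal ∂m01) ^ (1 / q.toReal) :=
          ENNReal.mul_rpow_of_nonneg _ _ (by positivity)
      _ ≤ _ := by
          gcongr
          calc (n : ℝ≥0∞) ^ (1 / q.toReal) ≤ (n : ℝ≥0∞) ^ (1 : ℝ) :=
                ENNReal.rpow_le_rpow_of_exponent_le hn1 (by rw [div_le_one hk0]; exact hk)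
            _ = n := ENNReal.rpow_one _

lemma lint_tail (h : ℝ → ℝ≥0∞) (hh : Measurable h) (t : ℝ) (ht : 0 < t) (ht1 : t ≤ 1) :
    ∫⁻ u in Ioc 0 t, ∫⁻ s in Ioc u 1, h s
      = (∫⁻ s in Ioc 0 t, ENNReal.ofReal s * h s) + ENNReal.ofReal t * ∫⁻ s in Ioc t 1, h s := by
  have f1 := fub (Ioc 0 t) (fun _ => 1) h measurable_const hh
  have e1 : ∫⁻ s in Ioc 0 t, h s * ∫⁻ u in Ioc 0 s, (1 : ℝ≥0∞) = ∫⁻ s in Ioc 0 t, ENNReal.ofReal s * h s := by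
    refine lintegral_congr fun s => ?_
    simp [mul_comm]
  rw [← e1, f1]
  have e2 : ENNReal.ofReal t * ∫⁻ s in Ioc t 1, h s = ∫⁻ u in Ioc 0 t, ∫⁻ s in Ioc t 1, h s := by
    simp [mul_comm]
  rw [e2, (Ioc_union_Ioi_eq_Ioi ht.le).symm, lintegral_union measurableSet_Ioi (Ioc_disjoint_Ioi le_rfl)]
  have z : ∫⁻ u in Ioi t, 1 * ∫⁻ s in Ioc 0 t ∩ Ici u, h s = 0 := by
    rw [setLIntegral_congr_fun (g := fun _ => 0) measurableSet_Ioi]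
    · simp
    · intro u hu
      have : Ioc 0 t ∩ Ici u = ∅ := by
        ext s; simp only [mem_inter_iff, mem_Ioc, mem_Ici, mem_empty_iff_false, iff_false]
        rintro ⟨⟨_, h⟩, h'⟩
        exact absurd (mem_Ioi.1 hu) (not_lt.2 (h'.trans h))
      simp [this]
  rw [z, add_zero, ← lintegral_add_right _ measurable_const]
  refine setLIntegral_congr_fun measurableSet_Ioc fun u hu => ?_
  have e : Ioc 0 t ∩ Ici u = Icc u t := by
    ext s; simp only [mem_inter_iff, mem_Ioc, mem_Ici, mem_Icc]
    exact ⟨fun h => ⟨h.2, h.1.2⟩, fun h => ⟨⟨hu.1.trans_le h.1, h.2⟩, h.1⟩⟩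
  simp only [e, one_mul]
  rw [setLIntegral_congr Ioc_ae_eq_Icc.symm, ← Ioc_union_Ioc_eq_Ioc hu.2 ht1,
    lintegral_union measurableSet_Ioc (Ioc_disjoint_Ioc_of_le le_rfl)]

/-- decreasing right-continuous functions are their own rearrangement -/
lemma decRearr_self (h : ℝ → ℝ≥0∞) 
    (hfin : ∀ t, 0 < t → ∫⁻ s in Ioc t 1, h s ≠ ∞) (t : ℝ) (ht : t ∈ Ioo (0 : ℝ) 1) :
    decRearr m01 (fun t => (∫⁻ s in Ioc t 1, h s).toReal) t = (∫⁻ s in Ioc t 1, h s).toReal := by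
  have hf : Measurable (fun t => (∫⁻ s in Ioc t 1, h s).toReal) :=
    (lint_anti_set h).measurable.ennreal_toReal
  have hanti : ∀ s t : ℝ, 0 < s → s ≤ t → (∫⁻ x in Ioc t 1, h x).toReal ≤ (∫⁻ x in Ioc s 1, h x).toReal :=
    fun s t hs hst => ENNReal.toReal_mono (hfin s hs) (lint_anti_set h hst)
  apply le_antisymm
  · refine csInf_le (decRearr_bdd _ _ _) ⟨ENNReal.toReal_nonneg, ?_⟩
    rw [m01, Measure.restrict_apply (measurableSet_lt measurable_const hf.abs)]
    calc _ ≤ volume (Ioo 0 t) := by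
          refine measure_mono ?_
          rintro x ⟨hx, hx0, hx1⟩
          refine ⟨hx0, ?_⟩
          by_contra! hle
          simp only [mem_ofPred_eq, abs_of_nonneg ENNReal.toReal_nonneg] at hx
          exact absurd (hanti t x ht.1 hle) (not_le.2 hx)
      _ = _ := by simp
  · refine le_csInf (decRearr_nonempty _ _ hf t ht.1) ?_
    rintro l ⟨hl, hl'⟩
    have h1 : ∀ x, t < x → x < 1 → (∫⁻ s in Ioc x 1, h s).toReal ≤ l := by
      intro x hx hx1
      by_contra! hlt
      have : ENNReal.ofReal x ≤ ENNReal.ofReal t := by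
        refine le_trans ?_ hl'
        rw [m01, Measure.restrict_apply (measurableSet_lt measurable_const hf.abs)]
        calc ENNReal.ofReal x = volume (Ioo 0 x) := by simp
          _ ≤ _ := by
            refine measure_mono ?_
            rintro y ⟨hy0, hyx⟩
            refine ⟨?_, hy0, hyx.trans hx1⟩
            simp only [mem_ofPred_eq, abs_of_nonneg ENNReal.toReal_nonneg]
            exact hlt.trans_le (hanti y x hy0 hyx.le)
      rw [ENNReal.ofReal_le_ofReal_iff ht.1.le] at this
      linarith
    refine ENNReal.toReal_le_of_le_ofReal hl ?_
    have hU : Ioc t 1 = ⋃ k : ℕ, Ioc (t + (1 - t) / ((k : ℝ) + 2)) 1 := by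
      ext x
      simp only [mem_iUnion, mem_Ioc]
      constructor
      · rintro ⟨hx, hx1⟩
        obtain ⟨k, hk⟩ := exists_nat_gt ((1 - t) / (x - t))
        refine ⟨k, ?_, hx1⟩
        have hxt : 0 < x - t := sub_pos.2 hx
        rw [div_lt_iff₀ hxt] at hk
        have : (1 - t) / ((k : ℝ) + 2) < x - t := by
          rw [div_lt_iff₀ (by positivity)]; nlinarith
        linarith
      · rintro ⟨k, hk, hx1⟩
        have : 0 < (1 - t) / ((k : ℝ) + 2) := div_pos (sub_pos.2 ht.2) (by positivity)
        exact ⟨by linarith, hx1⟩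
    have hmono : Monotone fun k : ℕ => Ioc (t + (1 - t) / ((k : ℝ) + 2)) 1 := by
      intro a b hab
      refine Ioc_subset_Ioc_left ?_
      have : (1 - t) / ((b : ℝ) + 2) ≤ (1 - t) / ((a : ℝ) + 2) := by
        have : (a : ℝ) ≤ b := by exact_mod_cast hab
        have := ht.2
        gcongr
      linarith
    rw [hU, ← withDensity_apply _ (MeasurableSet.iUnion fun _ => measurableSet_Ioc), hmono.measure_iUnion]
    refine iSup_le fun k => ?_
    rw [withDensity_apply _ measurableSet_Ioc]
    have hp : 0 < (1 - t) / ((k : ℝ) + 2) := div_pos (sub_pos.2 ht.2) (by positivity)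
    have hp2 : (1 - t) / ((k : ℝ) + 2) < 1 - t := by
      rw [div_lt_iff₀ (by positivity)]
      have := ht.2
      have : (0 : ℝ) ≤ k := by positivity
      nlinarith
    rw [← ENNReal.ofReal_toReal (hfin (t + (1 - t) / ((k : ℝ) + 2)) (by linarith [ht.1]))]
    exact ENNReal.ofReal_le_ofReal (h1 _ (by linarith) (by linarith))

lemma a_to_b (n : ℕ) (hn : 2 ≤ n) (q r : ℝ≥0∞) (hq : 1 ≤ q) (hr : 1 ≤ r) (C : ℝ) (hC : 0 ≤ C)
    (H : ∀ f : ℝ → ℝ, Measurable f → eLpNorm f r m01 ≤ ENNReal.ofReal C *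
      (eLpNorm (fun t => t ^ (-(1 : ℝ) / n) * (decRearrAvg m01 f t - decRearr m01 f t)) q m01
        + eLpNorm f 1 m01))
    (g : ℝ → ℝ) (hg : Measurable g) :
    eLp01 (fun t => ∫⁻ s in Ioc t 1, ENNReal.ofReal (s ^ ((1 : ℝ) / n) * g s / s)) r
      ≤ ENNReal.ofReal (C * (n + 1) + 1) * eLp01 (fun t => ENNReal.ofReal (g t)) q := by
  rw [eLp01_eq _ _ hr, eLp01_eq _ _ hq]
  set G : ℝ → ℝ≥0∞ := fun t => ENNReal.ofReal (g t) with hGdef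
  have hG : Measurable G := by fun_prop
  by_cases hN : eLpNorm G q m01 = ∞
  · rw [hN, ENNReal.mul_top]
    · exact le_top
    · simp; positivity
  have h1q : eLpNorm G 1 m01 ≤ eLpNorm G q m01 :=
    eLpNorm_le_eLpNorm_of_exponent_le hq hG.aestronglyMeasurable
  set h : ℝ → ℝ≥0∞ := fun s => ENNReal.ofReal (s ^ ((1 : ℝ) / n) * g s / s) with hh
  have hhm : Measurable h := by fun_prop
  have hsh : ∀ s, 0 < s → ENNReal.ofReal s * h s = ENNReal.ofReal (s ^ ((1 : ℝ) / n)) * G s := by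
    intro s hs
    simp only [hh, hGdef]
    rw [← ENNReal.ofReal_mul hs.le, ← ENNReal.ofReal_mul (by positivity)]
    congr 1; field_simp
  have hW : ∫⁻ s in Ioc 0 1, ENNReal.ofReal s * h s ≤ eLpNorm G q m01 := by
    refine le_trans ?_ h1q
    rw [eLpNorm_one_Ioc]
    refine setLIntegral_mono hG fun s hs => ?_
    rw [hsh s hs.1]
    refine mul_le_of_le_one_left zero_le ?_
    rw [ENNReal.ofReal_le_one]
    exact Real.rpow_le_one hs.1.le hs.2 (by positivity)
  have hWfin : ∫⁻ s in Ioc 0 1, ENNReal.ofReal s * h s ≠ ∞ := ne_top_of_le_ne_top hN hW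
  have hfin : ∀ t, 0 < t → ∫⁻ s in Ioc t 1, h s ≠ ∞ := by
    intro t ht
    have : ∫⁻ s in Ioc t 1, h s ≤ ENNReal.ofReal (1 / t) * ∫⁻ s in Ioc 0 1, ENNReal.ofReal s * h s := by
      rw [← lintegral_const_mul _ (by fun_prop)]
      refine (setLIntegral_mono (by fun_prop) fun s hs => ?_).trans
        (lintegral_mono_set (Ioc_subset_Ioc_left ht.le))
      rw [← mul_assoc, ← ENNReal.ofReal_mul (by positivity)]
      refine le_mul_of_one_le_left zero_le ?_
      rw [ENNReal.one_le_ofReal, one_div, inv_mul_eq_div, le_div_iff₀ ht]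
      linarith [hs.1]
    exact ne_top_of_le_ne_top (ENNReal.mul_ne_top ENNReal.ofReal_ne_top hWfin) this
  set HH : ℝ → ℝ≥0∞ := fun t => ∫⁻ s in Ioc t 1, h s with hHH
  have hHm : Measurable HH := (lint_anti_set h).measurable
  set f : ℝ → ℝ := fun t => (HH t).toReal with hfdef
  have hfm : Measurable f := hHm.ennreal_toReal
  have hfe : ∀ t ∈ Ioo (0 : ℝ) 1, ‖f t‖ₑ = ‖HH t‖ₑ := by
    intro t ht
    rw [enorm_eq_self, Real.enorm_of_nonneg ENNReal.toReal_nonneg, ENNReal.ofReal_toReal (hfin t ht.1)]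
  have hfr : ∀ p, eLpNorm f p m01 = eLpNorm HH p m01 := fun p => eLpNorm_congr01 p hfe
  have hf1 : eLpNorm f 1 m01 ≤ eLpNorm G q m01 := by
    rw [hfr, eLpNorm_one_Ioc, lint_tail h hhm 1 one_pos le_rfl]
    simpa using hW
  have hstar : ∀ t ∈ Ioo (0 : ℝ) 1, decRearr m01 f t = f t := fun t ht => decRearr_self h hfin t ht
  have hT : eLpNorm (fun t => t ^ (-(1 : ℝ) / n) * (decRearrAvg m01 f t - decRearr m01 f t)) q m01
      = eLpNorm (Th n G) q m01 := by
    refine eLpNorm_congr01 q fun t ht => ?_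
    have ht0 := ht.1
    set W := ∫⁻ s in Ioc 0 t, ENNReal.ofReal s * h s with hWd
    have hWt : W ≠ ∞ := ne_top_of_le_ne_top hWfin (lintegral_mono_set (Ioc_subset_Ioc_right ht.2.le))
    have havg : decRearrAvg m01 f t = (1 / t) * (W.toReal + t * f t) := by
      unfold decRearrAvg
      congr 1
      rw [setIntegral_congr_fun (g := f) measurableSet_Ioc
        (fun u hu => hstar u ⟨hu.1, hu.2.trans_lt ht.2⟩)]
      rw [hfdef, integral_toReal hHm.aemeasurable, lint_tail h hhm t ht.1 ht.2.le,
        ENNReal.toReal_add hWt (ENNReal.mul_ne_top ENNReal.ofReal_ne_top (hfin t ht.1)),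
        ENNReal.toReal_mul, ENNReal.toReal_ofReal ht.1.le]
      filter_upwards [ae_restrict_mem measurableSet_Ioc] with u hu
      exact (hfin u hu.1).lt_top
    have hTt : Th n G t = ENNReal.ofReal (t ^ (-(1 : ℝ) / n - 1)) * W := by
      unfold Th
      rw [hWd, setLIntegral_congr_fun measurableSet_Ioc (fun s hs => (hsh s hs.1).symm)]
    rw [enorm_eq_self, hTt, hstar t ht, havg]
    have e : t ^ (-(1 : ℝ) / n) * (1 / t * (W.toReal + t * f t) - f t)
        = t ^ (-(1 : ℝ) / n - 1) * W.toReal := by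
      rw [Real.rpow_sub_one ht0.ne']; field_simp; ring
    rw [e, Real.enorm_of_nonneg (by positivity), ENNReal.ofReal_mul (by positivity),
      ENNReal.ofReal_toReal hWt]
  have hmain := H f hfm
  rw [hT, hfr r] at hmain
  calc eLpNorm HH r m01 ≤ _ := hmain
    _ ≤ ENNReal.ofReal C * (n * eLpNorm G q m01 + eLpNorm G q m01) := by
        gcongr
        exact Th_Lq n hn q hq G hG
    _ = ENNReal.ofReal (C * (n + 1)) * eLpNorm G q m01 := by
        rw [ENNReal.ofReal_mul hC, ENNReal.ofReal_add (by positivity) zero_le_one,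
          ENNReal.ofReal_natCast, ENNReal.ofReal_one]; ring
    _ ≤ _ := by
        gcongr
        linarith

/-- For `n ≥ 2` and `q, r ∈ [1,∞]`, the inequality
`‖f‖_{L^r(0,1)} ≤ C (‖t^{−1/n}(f**(t) − f*(t))‖_{L^q(0,1)} + ‖f‖_{L^1(0,1)})`
for all measurable `f` on `(0,1)` is equivalent to the boundedness
`L^q(0,1) → L^r(0,1)` of the Hardy-type operator `g ↦ ∫ₜ¹ s^{1/n} g(s) ds/s`. -/
theorem stmt12 (n : ℕ) (hn : 2 ≤ n) (q r : ℝ≥0∞) (hq : 1 ≤ q) (hr : 1 ≤ r) :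
    (∃ C : ℝ, 0 ≤ C ∧ ∀ f : ℝ → ℝ, Measurable f →
        eLpNorm f r (volume.restrict (Ioo (0 : ℝ) 1))
          ≤ ENNReal.ofReal C *
            (eLpNorm
                (fun t => t ^ (-(1 : ℝ) / n) *
                  (decRearrAvg (volume.restrict (Ioo (0 : ℝ) 1)) f t
                    - decRearr (volume.restrict (Ioo (0 : ℝ) 1)) f t))
                q (volume.restrict (Ioo (0 : ℝ) 1))
              + eLpNorm f 1 (volume.restrict (Ioo (0 : ℝ) 1)))) ↔
      (∃ C' : ℝ, 0 ≤ C' ∧ ∀ g : ℝ → ℝ, Measurable g → (∀ s ∈ Ioo (0 : ℝ) 1, 0 ≤ g s) →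
        eLp01 (fun t => ∫⁻ s in Ioc t 1, ENNReal.ofReal (s ^ ((1 : ℝ) / n) * g s / s)) r
          ≤ ENNReal.ofReal C' * eLp01 (fun t => ENNReal.ofReal (g t)) q) := by
  constructor
  · rintro ⟨C, hC, H⟩
    exact ⟨C * (n + 1) + 1, by positivity, fun g hg _ => a_to_b n hn q r hq hr C hC H g hg⟩
  · rintro ⟨C', hC', H⟩
    exact ⟨C' + 1, by positivity, fun f hf => b_to_a n hn q r hq hr C' hC' H f hf⟩
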